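/- Let y ∈ ℝ^d, n ∈ ℕ, let the truncation function h be continuous, and let ψ : ℝ → [0,1] be a continuous function with ψ(u) = 1 for u ≥ −1+1/n and ψ(u) = 0 for u < −1+1/(2n). Define I_{y,n}(z) := I_y(z)·ψ(y^⊤z). Then: (i) there is a constant K such that the function z ↦ I_{y,n}(z)/(|z|²∧1) is continuous on ℝ^d∖{0} and bounded below by K on ℝ^d∖{0}; and (ii) the functional F ↦ ∫ I_{y,n}(z) F(dz), with values in (−∞,∞], is sequentially lower semicontinuous on the set of Lévy measures: if F_k, F are Lévy measures such that the finite measures |z|²∧1·F_k converge weakly (tested against bounded continuous functions) to |z|²∧1·F, then liminf_k ∫ I_{y,n}(z) F_k(dz) ≥ ∫ I_{y,n}(z) F(dz). -/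

import Mathlib

open MeasureTheory Filter Set
open scoped ENNReal NNReal Topology

noncomputable section

/-- The positive part of an extended real number, as an element of `ℝ≥0∞`. -/
def EReal.posPart (x : EReal) : ℝ≥0∞ := if x = ⊤ then ⊤ else ENNReal.ofReal x.toReal

/-- Integral of an `EReal`-valued function, defined as the difference of the lintegrals of
the positive and negative parts, with the conventions of `EReal` arithmetic
(in particular `∞ - ∞ = -∞`). -/
def eIntegral {α : Type*} [MeasurableSpace α] (F : Measure α) (f : α → EReal) : EReal :=
  ((∫⁻ z, (f z).posPart ∂F : ℝ≥0∞) : EReal) - ((∫⁻ z, (-(f z)).posPart ∂F : ℝ≥0∞) : EReal)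

/-- The dot product `y^⊤ z` on `ℝ^d`. -/
def dotp {d : ℕ} (y z : EuclideanSpace ℝ (Fin d)) : ℝ := ∑ i, y i * z i

/-- The quadratic form `y^⊤ c y`. -/
def quadf {d : ℕ} (c : Matrix (Fin d) (Fin d) ℝ) (y : EuclideanSpace ℝ (Fin d)) : ℝ :=
  ∑ i, ∑ j, c i j * y i * y j

/-- The (Frobenius) norm `|c|` of a matrix. -/
def matNorm {d : ℕ} (c : Matrix (Fin d) (Fin d) ℝ) : ℝ :=
  Real.sqrt (∑ i, ∑ j, (c i j) ^ 2)

/-- A Lévy measure on `ℝ^d`: a (Borel) measure with `F({0}) = 0` and `∫ |z|² ∧ 1 F(dz) < ∞`. -/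
def IsLevyMeasure {d : ℕ} (F : Measure (EuclideanSpace ℝ (Fin d))) : Prop :=
  F {0} = 0 ∧ ∫⁻ z, ENNReal.ofReal (min (‖z‖ ^ 2) 1) ∂F < ⊤

/-- A truncation function: bounded, measurable, equal to the identity near the origin. -/
structure IsTruncation {d : ℕ}
    (h : EuclideanSpace ℝ (Fin d) → EuclideanSpace ℝ (Fin d)) : Prop where
  measurable : Measurable h
  bounded : ∃ M : ℝ, ∀ z, ‖h z‖ ≤ M
  eq_id_near_zero : ∃ δ : ℝ, 0 < δ ∧ ∀ z, ‖z‖ < δ → h z = z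

/-- The integrand `I_y(z)`, as an extended real number:
`log(1+y^⊤z) - y^⊤h(z)` if `p = 0`, and `p⁻¹(1+y^⊤z)^p - p⁻¹ - y^⊤h(z)` if `p ≠ 0`,
with the conventions `log 0 = -∞` and `0^p = +∞` for `p < 0` (so that the integrand
is `-∞` on `{1 + y^⊤z ≤ 0}` when `p ≤ 0`). -/
def Ifun {d : ℕ} (p : ℝ) (h : EuclideanSpace ℝ (Fin d) → EuclideanSpace ℝ (Fin d))
    (y z : EuclideanSpace ℝ (Fin d)) : EReal :=
  if 0 < 1 + dotp y z then
    (if p = 0 then ((Real.log (1 + dotp y z) - dotp y (h z) : ℝ) : EReal)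
      else ((p⁻¹ * (1 + dotp y z) ^ p - p⁻¹ - dotp y (h z) : ℝ) : EReal))
  else if p ≤ 0 then (⊥ : EReal)
  else ((p⁻¹ * (1 + dotp y z) ^ p - p⁻¹ - dotp y (h z) : ℝ) : EReal)

/-- The function `g^{(b,c,F)}(y) = y^⊤b + ((p-1)/2)·y^⊤cy + ∫ I_y(z) F(dz)`. -/
def gfun {d : ℕ} (p : ℝ) (h : EuclideanSpace ℝ (Fin d) → EuclideanSpace ℝ (Fin d))
    (b : EuclideanSpace ℝ (Fin d)) (c : Matrix (Fin d) (Fin d) ℝ)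
    (F : Measure (EuclideanSpace ℝ (Fin d))) (y : EuclideanSpace ℝ (Fin d)) : EReal :=
  ((dotp y b + (p - 1) / 2 * quadf c y : ℝ) : EReal) + eIntegral F (fun z => Ifun p h y z)

/-- Triples `θ = (b, c, F)`. -/
abbrev Triple (d : ℕ) :=
  EuclideanSpace ℝ (Fin d) × Matrix (Fin d) (Fin d) ℝ × Measure (EuclideanSpace ℝ (Fin d))

/-- `g^θ(y)` for a triple `θ = (b,c,F)`. -/
def gTheta {d : ℕ} (p : ℝ) (h : EuclideanSpace ℝ (Fin d) → EuclideanSpace ℝ (Fin d))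
    (θ : Triple d) (y : EuclideanSpace ℝ (Fin d)) : EReal :=
  gfun p h θ.1 θ.2.1 θ.2.2 y

/-- The integrand appearing in the definition of the constant `K`, depending on `p`
(and an extra parameter `ε > 0` when `p ∈ (0,1)`). -/
def Kintegrand {d : ℕ} (p ε : ℝ) (z : EuclideanSpace ℝ (Fin d)) : ℝ :=
  if p = 0 then min (‖z‖ ^ 2) (Real.log (1 + ‖z‖))
  else if 0 < p then min (‖z‖ ^ 2) (‖z‖ ^ (p * (1 + ε)))
  else min (‖z‖ ^ 2) 1

/-- The natural constraints `C⁰ = ∩_{F ∈ L_Θ} {y : F({z : y^⊤z < -1}) = 0}`. -/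
def natC {d : ℕ} (Θ : Set (Triple d)) : Set (EuclideanSpace ℝ (Fin d)) :=
  {y | ∀ θ ∈ Θ, θ.2.2 {z | dotp y z < -1} = 0}

/-- The sets `C⁰ₙ = ∩_{F ∈ L_Θ} {y : F({z : y^⊤z < -1 + 1/n}) = 0}`. -/
def natCn {d : ℕ} (Θ : Set (Triple d)) (n : ℕ) : Set (EuclideanSpace ℝ (Fin d)) :=
  {y | ∀ θ ∈ Θ, θ.2.2 {z | dotp y z < -1 + 1 / (n : ℝ)} = 0}

/-- The finite measure `|z|² ∧ 1 · F`. -/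
def sq1Measure {d : ℕ} (F : Measure (EuclideanSpace ℝ (Fin d))) :
    Measure (EuclideanSpace ℝ (Fin d)) :=
  F.withDensity (fun z => ENNReal.ofReal (min (‖z‖ ^ 2) 1))

/-- The standing assumptions of the paper: `p = 0` or `p ∈ (-∞,0) ∪ (0,1)`, `ε > 0`,
`h` is a truncation function, `Θ` is a nonempty convex set of Lévy triplets with `K < ∞`,
`C` is closed, convex and contains `0`, and `C ∩ C⁰` is compact. -/
structure Standing {d : ℕ} (p ε : ℝ)
    (h : EuclideanSpace ℝ (Fin d) → EuclideanSpace ℝ (Fin d))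
    (Θ : Set (Triple d)) (C : Set (EuclideanSpace ℝ (Fin d))) : Prop where
  p_range : p = 0 ∨ p < 0 ∨ (0 < p ∧ p < 1)
  eps_pos : 0 < ε
  trunc : IsTruncation h
  Theta_nonempty : Θ.Nonempty
  Theta_psd : ∀ θ ∈ Θ, (θ.2.1).PosSemidef
  Theta_levy : ∀ θ ∈ Θ, IsLevyMeasure θ.2.2
  Theta_convex : ∀ θ₁ ∈ Θ, ∀ θ₂ ∈ Θ, ∀ t : ℝ, 0 ≤ t → t ≤ 1 →
    (t • θ₁.1 + (1 - t) • θ₂.1, t • θ₁.2.1 + (1 - t) • θ₂.2.1,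
      ENNReal.ofReal t • θ₁.2.2 + ENNReal.ofReal (1 - t) • θ₂.2.2) ∈ Θ
  K_finite : ∃ K : ℝ, ∀ θ ∈ Θ,
    (∫⁻ z, ENNReal.ofReal (Kintegrand p ε z) ∂θ.2.2) ≠ ⊤ ∧
    ‖θ.1‖ + matNorm θ.2.1 + (∫⁻ z, ENNReal.ofReal (Kintegrand p ε z) ∂θ.2.2).toReal ≤ K
  C_closed : IsClosed C
  C_convex : Convex ℝ C
  C_zero : (0 : EuclideanSpace ℝ (Fin d)) ∈ C
  CC0_compact : IsCompact (C ∩ natC Θ)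

/-- The cut-off integrand `I_{y,n}(z) = I_y(z)·ψ(y^⊤z)`, which is real-valued. -/
def Icut {d : ℕ} (p : ℝ) (h : EuclideanSpace ℝ (Fin d) → EuclideanSpace ℝ (Fin d))
    (ψ : ℝ → ℝ) (y z : EuclideanSpace ℝ (Fin d)) : ℝ :=
  (((ψ (dotp y z) : ℝ) : EReal) * Ifun p h y z).toReal

lemma EReal.posPart_coe (x : ℝ) : (x : EReal).posPart = ENNReal.ofReal x := by
  simp [EReal.posPart]

/-- If the negative part of `f` is dominated by an integrable function `k`, then the integral of
`f` is that of the nonnegative function `f + k` minus that of `k`. -/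
lemma eIntegral_coe_eq_lintegral_add_sub {α : Type*} [MeasurableSpace α] (F : Measure α)
    {f k : α → ℝ} (hf : Measurable f) (hk : Measurable k) (hk0 : ∀ z, 0 ≤ k z)
    (hfk : ∀ z, 0 ≤ f z + k z) (hkint : ∫⁻ z, ENNReal.ofReal (k z) ∂F ≠ ⊤) :
    eIntegral F (fun z => (f z : EReal)) =
      ((∫⁻ z, ENNReal.ofReal (f z + k z) ∂F : ℝ≥0∞) : EReal)
        - ((∫⁻ z, ENNReal.ofReal (k z) ∂F : ℝ≥0∞) : EReal) := by
  have hneg : ∫⁻ z, ENNReal.ofReal (-f z) ∂F ≠ ⊤ := by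
    refine ne_top_of_le_ne_top hkint (lintegral_mono fun z => ENNReal.ofReal_le_ofReal ?_)
    linarith [hfk z]
  have hsum : ∫⁻ z, ENNReal.ofReal (f z) ∂F + ∫⁻ z, ENNReal.ofReal (k z) ∂F =
      ∫⁻ z, ENNReal.ofReal (f z + k z) ∂F + ∫⁻ z, ENNReal.ofReal (-f z) ∂F := by
    rw [← lintegral_add_left (by fun_prop), ← lintegral_add_left (by fun_prop)]
    refine lintegral_congr fun z => ?_
    rcases le_total 0 (f z) with h0 | h0
    · rw [ENNReal.ofReal_add h0 (hk0 z), ENNReal.ofReal_of_nonpos (neg_nonpos.2 h0), add_zero]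
    · rw [← ENNReal.ofReal_add (hfk z) (neg_nonneg.2 h0), ENNReal.ofReal_of_nonpos h0, zero_add]
      congr 1; ring
  simp only [eIntegral, ← EReal.coe_neg, EReal.posPart_coe]
  generalize ∫⁻ z, ENNReal.ofReal (f z) ∂F = P at *
  generalize ∫⁻ z, ENNReal.ofReal (k z) ∂F = B at *
  generalize ∫⁻ z, ENNReal.ofReal (f z + k z) ∂F = A at *
  generalize ∫⁻ z, ENNReal.ofReal (-f z) ∂F = N at *
  lift B to ℝ≥0 using hkint
  lift N to ℝ≥0 using hneg
  by_cases hP : P = ⊤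
  · have hA : A = ⊤ := by simpa [hP, eq_comm] using hsum
    rw [hP, hA, EReal.coe_ennreal_top, EReal.coe_nnreal_eq_coe_real,
      EReal.coe_nnreal_eq_coe_real, EReal.top_sub_coe, EReal.top_sub_coe]
  · have hA : A ≠ ⊤ := by
      rintro rfl
      simp [hP] at hsum
    lift P to ℝ≥0 using hP
    lift A to ℝ≥0 using hA
    simp only [EReal.coe_nnreal_eq_coe_real, ← EReal.coe_sub]
    have hsum' : (P : ℝ) + B = A + N := by exact_mod_cast hsum
    congr 1
    linarith

section LowerSemicontinuity

variable {d : ℕ}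

lemma isFiniteMeasure_sq1Measure {F : Measure (EuclideanSpace ℝ (Fin d))}
    (hF : IsLevyMeasure F) : IsFiniteMeasure (sq1Measure F) :=
  isFiniteMeasure_withDensity hF.2.ne

lemma lintegral_sq1Measure (F : Measure (EuclideanSpace ℝ (Fin d)))
    {g : EuclideanSpace ℝ (Fin d) → ℝ} (hg : Measurable g) :
    ∫⁻ z, ENNReal.ofReal (g z) ∂(sq1Measure F) =
      ∫⁻ z, ENNReal.ofReal (min (‖z‖ ^ 2) 1 * g z) ∂F := by
  rw [sq1Measure, lintegral_withDensity_eq_lintegral_mul _ (by fun_prop) (by fun_prop)]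
  refine lintegral_congr fun z => ?_
  rw [Pi.mul_apply, ← ENNReal.ofReal_mul (by positivity)]

/-- Bounded continuous approximations from below of the density `(f z + c (|z|² ∧ 1)) / (|z|² ∧ 1)`,
which may be undefined at the origin. -/
def truncDensity (f : EuclideanSpace ℝ (Fin d) → ℝ) (c : ℝ) (m : ℕ)
    (z : EuclideanSpace ℝ (Fin d)) : ℝ :=
  min (m : ℝ) ((f z + c * min (‖z‖ ^ 2) 1) / (min (‖z‖ ^ 2) 1 + 1 / ((m : ℝ) + 1)))

variable {f : EuclideanSpace ℝ (Fin d) → ℝ} {c : ℝ}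

lemma continuous_truncDensity (hf : Continuous f) (c : ℝ) (m : ℕ) :
    Continuous (truncDensity f c m) := by
  unfold truncDensity
  refine continuous_const.min (Continuous.div (by fun_prop) (by fun_prop) fun z => ?_)
  positivity

lemma truncDensity_nonneg (hfc : ∀ z, 0 ≤ f z + c * min (‖z‖ ^ 2) 1) (m : ℕ)
    (z : EuclideanSpace ℝ (Fin d)) : 0 ≤ truncDensity f c m z :=
  le_min m.cast_nonneg (div_nonneg (hfc z) (by positivity))

lemma truncDensity_le (m : ℕ) (z : EuclideanSpace ℝ (Fin d)) : truncDensity f c m z ≤ m :=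
  min_le_left _ _

lemma monotone_truncDensity (hfc : ∀ z, 0 ≤ f z + c * min (‖z‖ ^ 2) 1)
    (z : EuclideanSpace ℝ (Fin d)) : Monotone fun m => truncDensity f c m z := by
  intro m m' hm
  have := hfc z
  simp only [truncDensity]
  gcongr

lemma tendsto_mul_truncDensity {z : EuclideanSpace ℝ (Fin d)} (hz : z ≠ 0) :
    Tendsto (fun m => min (‖z‖ ^ 2) 1 * truncDensity f c m z) atTop
      (𝓝 (f z + c * min (‖z‖ ^ 2) 1)) := by
  have hφ : 0 < min (‖z‖ ^ 2) 1 := by positivity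
  have hlim : Tendsto (fun m : ℕ => (f z + c * min (‖z‖ ^ 2) 1) /
      (min (‖z‖ ^ 2) 1 + 1 / ((m : ℝ) + 1))) atTop
      (𝓝 ((f z + c * min (‖z‖ ^ 2) 1) / min (‖z‖ ^ 2) 1)) := by
    refine tendsto_const_nhds.div ?_ hφ.ne'
    simpa using tendsto_const_nhds.add (tendsto_one_div_add_atTop_nhds_zero_nat (𝕜 := ℝ))
  have hev : ∀ᶠ m : ℕ in atTop, (f z + c * min (‖z‖ ^ 2) 1) /
      (min (‖z‖ ^ 2) 1 + 1 / ((m : ℝ) + 1)) = truncDensity f c m z := by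
    filter_upwards [hlim.eventually_le_const (lt_add_one _),
      tendsto_natCast_atTop_atTop.eventually_ge_atTop
        ((f z + c * min (‖z‖ ^ 2) 1) / min (‖z‖ ^ 2) 1 + 1)] with m h1 h2
    exact (min_eq_right (h1.trans h2)).symm
  convert! (hlim.congr' hev).const_mul (min (‖z‖ ^ 2) 1) using 2
  field_simp

lemma IsLevyMeasure.ae_ne_zero {F : Measure (EuclideanSpace ℝ (Fin d))} (hF : IsLevyMeasure F) :
    ∀ᵐ z ∂F, z ≠ 0 := by
  rw [ae_iff]
  simpa using hF.1

lemma integral_truncDensity_sub {F : Measure (EuclideanSpace ℝ (Fin d))} (hF : IsLevyMeasure F)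
    (hf : Continuous f) (hc : 0 ≤ c) (hfc : ∀ z, 0 ≤ f z + c * min (‖z‖ ^ 2) 1) (m : ℕ) :
    ((∫ z, (truncDensity f c m z - c) ∂(sq1Measure F) : ℝ) : EReal) =
      ((∫⁻ z, ENNReal.ofReal (min (‖z‖ ^ 2) 1 * truncDensity f c m z) ∂F : ℝ≥0∞) : EReal)
        - ((∫⁻ z, ENNReal.ofReal (c * min (‖z‖ ^ 2) 1) ∂F : ℝ≥0∞) : EReal) := by
  have := isFiniteMeasure_sq1Measure hF
  have hcont := continuous_truncDensity hf c m
  have hint : Integrable (truncDensity f c m) (sq1Measure F) := by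
    refine Integrable.of_bound hcont.aestronglyMeasurable (m : ℝ) (ae_of_all _ fun z => ?_)
    rw [Real.norm_of_nonneg (truncDensity_nonneg hfc m z)]
    exact truncDensity_le m z
  simp only [mul_comm c]
  rw [integral_sub hint (integrable_const c), ← lintegral_sq1Measure F hcont.measurable,
    ← lintegral_sq1Measure F (g := fun _ => c) measurable_const,
    ← ofReal_integral_eq_lintegral_ofReal hint (ae_of_all _ (truncDensity_nonneg hfc m)),
    ← ofReal_integral_eq_lintegral_ofReal (integrable_const c) (ae_of_all _ fun _ => hc),
    EReal.coe_ennreal_ofReal, EReal.coe_ennreal_ofReal,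
    max_eq_left (integral_nonneg (truncDensity_nonneg hfc m)),
    max_eq_left (integral_nonneg fun _ => hc), EReal.coe_sub]

lemma lintegral_const_mul_ne_top {F : Measure (EuclideanSpace ℝ (Fin d))} (hF : IsLevyMeasure F)
    (hc : 0 ≤ c) : ∫⁻ z, ENNReal.ofReal (c * min (‖z‖ ^ 2) 1) ∂F ≠ ⊤ := by
  simp only [ENNReal.ofReal_mul hc]
  rw [lintegral_const_mul _ (by fun_prop)]
  exact ENNReal.mul_ne_top ENNReal.ofReal_ne_top hF.2.ne

lemma eIntegral_eq_of_levy {F : Measure (EuclideanSpace ℝ (Fin d))} (hF : IsLevyMeasure F)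
    (hf : Continuous f) (hc : 0 ≤ c) (hfc : ∀ z, 0 ≤ f z + c * min (‖z‖ ^ 2) 1) :
    eIntegral F (fun z => (f z : EReal)) =
      ((∫⁻ z, ENNReal.ofReal (f z + c * min (‖z‖ ^ 2) 1) ∂F : ℝ≥0∞) : EReal)
        - ((∫⁻ z, ENNReal.ofReal (c * min (‖z‖ ^ 2) 1) ∂F : ℝ≥0∞) : EReal) :=
  eIntegral_coe_eq_lintegral_add_sub F hf.measurable (by fun_prop)
    (fun z => by positivity) hfc (lintegral_const_mul_ne_top hF hc)

lemma tendsto_lintegral_truncDensity {F : Measure (EuclideanSpace ℝ (Fin d))}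
    (hF : IsLevyMeasure F) (hf : Continuous f) (hfc : ∀ z, 0 ≤ f z + c * min (‖z‖ ^ 2) 1) :
    Tendsto (fun m => ∫⁻ z, ENNReal.ofReal (min (‖z‖ ^ 2) 1 * truncDensity f c m z) ∂F) atTop
      (𝓝 (∫⁻ z, ENNReal.ofReal (f z + c * min (‖z‖ ^ 2) 1) ∂F)) := by
  refine lintegral_tendsto_of_tendsto_of_monotone (fun m => ?_) (ae_of_all _ fun z m m' hm => ?_) ?_
  · have := (continuous_truncDensity hf c m).measurable
    fun_prop
  · have := monotone_truncDensity hfc z hm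
    dsimp only at this ⊢
    gcongr
  · filter_upwards [hF.ae_ne_zero] with z hz
    exact (ENNReal.continuous_ofReal.tendsto _).comp (tendsto_mul_truncDensity hz)

lemma tendsto_integral_truncDensity_sub {F : Measure (EuclideanSpace ℝ (Fin d))}
    (hF : IsLevyMeasure F) (hf : Continuous f) (hc : 0 ≤ c)
    (hfc : ∀ z, 0 ≤ f z + c * min (‖z‖ ^ 2) 1) :
    Tendsto (fun m => ((∫ z, (truncDensity f c m z - c) ∂(sq1Measure F) : ℝ) : EReal)) atTop
      (𝓝 (eIntegral F (fun z => (f z : EReal)))) := by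
  simp only [eIntegral_eq_of_levy hF hf hc hfc, integral_truncDensity_sub hF hf hc hfc]
  have hB := lintegral_const_mul_ne_top hF hc
  have hlim := (continuous_coe_ennreal_ereal.tendsto _).comp
    (tendsto_lintegral_truncDensity hF hf hfc)
  simp only [sub_eq_add_neg]
  refine (EReal.continuousAt_add (p := (_, _)) (Or.inr ?_) (Or.inl ?_)).tendsto.comp
    (hlim.prodMk_nhds tendsto_const_nhds)
  · simpa [EReal.neg_eq_bot_iff] using hB
  · exact EReal.coe_ennreal_ne_bot _

lemma integral_truncDensity_sub_le {F : Measure (EuclideanSpace ℝ (Fin d))}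
    (hF : IsLevyMeasure F) (hf : Continuous f) (hc : 0 ≤ c)
    (hfc : ∀ z, 0 ≤ f z + c * min (‖z‖ ^ 2) 1) (m : ℕ) :
    ((∫ z, (truncDensity f c m z - c) ∂(sq1Measure F) : ℝ) : EReal) ≤
      eIntegral F (fun z => (f z : EReal)) := by
  refine Monotone.ge_of_tendsto (fun m m' hm => ?_)
    (tendsto_integral_truncDensity_sub hF hf hc hfc) m
  simp only [integral_truncDensity_sub hF hf hc hfc]
  refine EReal.sub_le_sub
    (EReal.coe_ennreal_le_coe_ennreal_iff.2 (lintegral_mono fun z => ?_)) le_rfl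
  have := monotone_truncDensity hfc z hm
  dsimp only at this ⊢
  gcongr

/-- The integral of a continuous function bounded below by a multiple of `|z|² ∧ 1` is
sequentially lower semicontinuous on Lévy measures. -/
lemma eIntegral_le_liminf {Fseq : ℕ → Measure (EuclideanSpace ℝ (Fin d))}
    {F : Measure (EuclideanSpace ℝ (Fin d))} (hFseq : ∀ k, IsLevyMeasure (Fseq k))
    (hF : IsLevyMeasure F)
    (hlim : ∀ g : EuclideanSpace ℝ (Fin d) → ℝ, Continuous g → (∃ M : ℝ, ∀ x, |g x| ≤ M) →
      Tendsto (fun k => ∫ z, g z ∂(sq1Measure (Fseq k))) atTop (𝓝 (∫ z, g z ∂(sq1Measure F))))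
    (hf : Continuous f) (hc : 0 ≤ c) (hfc : ∀ z, 0 ≤ f z + c * min (‖z‖ ^ 2) 1) :
    eIntegral F (fun z => (f z : EReal)) ≤
      liminf (fun k => eIntegral (Fseq k) (fun z => (f z : EReal))) atTop := by
  refine le_of_tendsto' (tendsto_integral_truncDensity_sub hF hf hc hfc) fun m => ?_
  have hm := hlim (fun z => truncDensity f c m z - c)
    ((continuous_truncDensity hf c m).sub continuous_const)
    ⟨m + c, fun z => abs_le.2 ⟨?_, ?_⟩⟩
  · rw [← (EReal.tendsto_coe.2 hm).liminf_eq]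
    exact liminf_le_liminf (.of_forall fun k =>
      integral_truncDensity_sub_le (hFseq k) hf hc hfc m)
  · linarith [truncDensity_nonneg hfc m z, m.cast_nonneg (α := ℝ)]
  · linarith [truncDensity_le (f := f) (c := c) m z]

end LowerSemicontinuity

section Utility

/-- The normalised power utility, with the logarithm for `p = 0`. -/
def powerUtility (p x : ℝ) : ℝ := if p = 0 then Real.log x else p⁻¹ * x ^ p - p⁻¹

lemma continuousOn_powerUtility (p : ℝ) : ContinuousOn (powerUtility p) (Ioi 0) := by
  intro x hx
  refine ContinuousAt.continuousWithinAt ?_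
  have hx0 : x ≠ 0 := (mem_Ioi.1 hx).ne'
  unfold powerUtility
  split_ifs
  · exact Real.continuousAt_log hx0
  · exact ((Real.continuousAt_rpow_const x p (Or.inl hx0)).const_mul _).sub continuousAt_const

lemma monotoneOn_powerUtility (p : ℝ) : MonotoneOn (powerUtility p) (Ioi 0) := by
  intro x hx x' hx' hxx'
  rw [mem_Ioi] at hx hx'
  unfold powerUtility
  split_ifs with hp
  · exact Real.log_le_log hx hxx'
  · refine sub_le_sub_right ?_ _
    rcases lt_or_gt_of_ne hp with hp | hp
    · exact mul_le_mul_of_nonpos_left (Real.rpow_le_rpow_of_nonpos hx hxx' hp.le)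
        (inv_nonpos.2 hp.le)
    · exact mul_le_mul_of_nonneg_left (Real.rpow_le_rpow hx.le hxx' hp.le) (inv_nonneg.2 hp.le)

lemma log_sub_le_powerUtility {p x : ℝ} (hx : 0 < x) (hpx : |Real.log x * p| ≤ 1) :
    Real.log x - |p| * Real.log x ^ 2 ≤ powerUtility p x := by
  unfold powerUtility
  split_ifs with hp
  · simp [hp]
  · have hexp := Real.abs_exp_sub_one_sub_id_le hpx
    have hfac : p⁻¹ * x ^ p - p⁻¹ - Real.log x =
        p⁻¹ * (Real.exp (Real.log x * p) - 1 - Real.log x * p) := by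
      rw [Real.rpow_def_of_pos hx]
      field_simp
    have habs : |p⁻¹ * x ^ p - p⁻¹ - Real.log x| ≤ |p| * Real.log x ^ 2 := by
      rw [hfac, abs_mul, abs_inv]
      calc |p|⁻¹ * |Real.exp (Real.log x * p) - 1 - Real.log x * p|
          ≤ |p|⁻¹ * (Real.log x * p) ^ 2 := by gcongr
        _ = |p| * Real.log x ^ 2 := by
          have : |p| ≠ 0 := abs_ne_zero.2 hp
          rw [mul_pow, ← sq_abs p]
          field_simp
    linarith [(abs_le.1 habs).1]

lemma sub_le_powerUtility_one_add {p u : ℝ} (hu : |u| ≤ 1 / 2) (hpu : 2 * |p| * |u| ≤ 1) :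
    u - (2 + 4 * |p|) * u ^ 2 ≤ powerUtility p (1 + u) := by
  obtain ⟨hu1, hu2⟩ := abs_le.1 hu
  have hx : 0 < 1 + u := by linarith
  have hlow : u - 2 * u ^ 2 ≤ Real.log (1 + u) := by
    refine le_trans ?_ (Real.one_sub_inv_le_log_of_pos hx)
    have : 1 - (1 + u)⁻¹ = u / (1 + u) := by field_simp; ring
    rw [this, le_div_iff₀ hx]
    nlinarith [mul_nonneg (sq_nonneg u) (by linarith : 0 ≤ 1 + 2 * u)]
  have hup : Real.log (1 + u) ≤ u := by linarith [Real.log_le_sub_one_of_pos hx]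
  have habs : |Real.log (1 + u)| ≤ 2 * |u| := by
    refine abs_le.2 ⟨?_, by linarith [le_abs_self u, abs_nonneg u]⟩
    nlinarith [sq_abs u, abs_nonneg u, neg_abs_le u]
  have hsq : Real.log (1 + u) ^ 2 ≤ 4 * u ^ 2 := by
    rw [← sq_abs (Real.log (1 + u)), ← sq_abs u]
    nlinarith [abs_nonneg (Real.log (1 + u)), abs_nonneg u]
  have hp0 := abs_nonneg p
  have := log_sub_le_powerUtility (p := p) hx (by
    rw [abs_mul]
    nlinarith)
  nlinarith [mul_le_mul_of_nonneg_left hsq hp0]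

end Utility

section CutOff

variable {d : ℕ}

lemma dotp_eq_inner (y z : EuclideanSpace ℝ (Fin d)) : dotp y z = inner ℝ y z := by
  simp [dotp, PiLp.inner_apply, mul_comm]

lemma abs_dotp_le (y z : EuclideanSpace ℝ (Fin d)) : |dotp y z| ≤ ‖y‖ * ‖z‖ := by
  rw [dotp_eq_inner]
  exact abs_real_inner_le_norm y z

lemma continuous_dotp (y : EuclideanSpace ℝ (Fin d)) : Continuous (dotp y) := by
  unfold dotp
  fun_prop

variable {p a : ℝ} {h : EuclideanSpace ℝ (Fin d) → EuclideanSpace ℝ (Fin d)}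
  {ψ : ℝ → ℝ} {y : EuclideanSpace ℝ (Fin d)}

/-- The integrand may be evaluated at `max (y^⊤z) a`, since the cut-off vanishes below `a`. -/
lemma Icut_eq (ha : -1 < a) (hψa : ∀ u < a, ψ u = 0) (z : EuclideanSpace ℝ (Fin d)) :
    Icut p h ψ y z =
      ψ (dotp y z) * (powerUtility p (1 + max (dotp y z) a) - dotp y (h z)) := by
  unfold Icut
  rcases lt_or_ge (dotp y z) a with hz | hz
  · simp [hψa _ hz]
  · rw [max_eq_left hz, Ifun, if_pos (by linarith), powerUtility]
    split_ifs <;> rw [← EReal.coe_mul, EReal.toReal_coe]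

lemma continuous_Icut (ha : -1 < a) (hψa : ∀ u < a, ψ u = 0) (hψ : Continuous ψ)
    (hh : Continuous h) : Continuous (Icut p h ψ y) := by
  have hy := continuous_dotp y
  have hU : Continuous fun z => powerUtility p (1 + max (dotp y z) a) :=
    (continuousOn_powerUtility p).comp_continuous (by fun_prop) fun z => by
      rw [mem_Ioi]
      linarith [le_max_right (dotp y z) a]
  rw [funext (Icut_eq (p := p) (h := h) (y := y) ha hψa)]
  fun_prop

/-- The cut-off integrand is bounded below by a multiple of `|z|² ∧ 1`: near the origin by Taylor
expansion, and elsewhere by monotonicity of the utility and boundedness of `h`. -/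
lemma exists_Icut_add_nonneg (ha : -1 < a) (hψa : ∀ u < a, ψ u = 0)
    (hψ01 : ∀ u, ψ u ∈ Icc (0 : ℝ) 1) (hh : IsTruncation h) :
    ∃ c : ℝ, 0 ≤ c ∧ ∀ z, 0 ≤ Icut p h ψ y z + c * min (‖z‖ ^ 2) 1 := by
  obtain ⟨M, hM⟩ := hh.bounded
  obtain ⟨δ, hδ, hδh⟩ := hh.eq_id_near_zero
  have hM0 : 0 ≤ M := (norm_nonneg _).trans (hM 0)
  set r : ℝ := min (min δ 1) (1 / (2 * (1 + |p|) * (1 + ‖y‖)))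
  have hr0 : 0 < r := by positivity
  set C₁ : ℝ := (2 + 4 * |p|) * ‖y‖ ^ 2
  set C₂ : ℝ := |powerUtility p (1 + a)| + ‖y‖ * M
  have hC₁ : 0 ≤ C₁ := by positivity
  have hC₂ : 0 ≤ C₂ := by positivity
  refine ⟨C₁ + C₂ / r ^ 2, by positivity, fun z => ?_⟩
  obtain ⟨hψ0, hψ1⟩ := hψ01 (dotp y z)
  have hψneg {t C : ℝ} (hC : 0 ≤ C) (ht : -C ≤ t) : -C ≤ ψ (dotp y z) * t := by
    nlinarith [mul_le_mul_of_nonneg_left ht hψ0]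
  have hy := abs_dotp_le y z
  have hr1 : r ≤ 1 := (min_le_left _ _).trans (min_le_right _ _)
  rcases lt_or_ge ‖z‖ r with hz | hz
  · have hφ : min (‖z‖ ^ 2) 1 = ‖z‖ ^ 2 := min_eq_left (by nlinarith [norm_nonneg z])
    have hsmall : ‖y‖ * ‖z‖ * (2 * (1 + |p|)) ≤ 1 := by
      have h1 : ‖z‖ ≤ 1 / (2 * (1 + |p|) * (1 + ‖y‖)) := hz.le.trans (min_le_right _ _)
      rw [le_div_iff₀ (by positivity)] at h1
      have : 0 ≤ ‖z‖ * (2 * (1 + |p|)) := by positivity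
      nlinarith
    have hp0 := abs_nonneg p
    have hu0 := abs_nonneg (dotp y z)
    have hyz : 0 ≤ ‖y‖ * ‖z‖ := by positivity
    have hu : |dotp y z| ≤ 1 / 2 := by nlinarith
    have hpu : 2 * |p| * |dotp y z| ≤ 1 := by nlinarith
    have hU := sub_le_powerUtility_one_add hu hpu
    have hmono : powerUtility p (1 + dotp y z) ≤ powerUtility p (1 + max (dotp y z) a) := by
      refine monotoneOn_powerUtility p ?_ ?_ (by gcongr; exact le_max_left _ _)
      · rw [mem_Ioi]; linarith [(abs_le.1 hu).1]
      · rw [mem_Ioi]; linarith [le_max_right (dotp y z) a]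
    have hsq : (2 + 4 * |p|) * dotp y z ^ 2 ≤ C₁ * ‖z‖ ^ 2 := by
      have : dotp y z ^ 2 ≤ (‖y‖ * ‖z‖) ^ 2 := by
        rw [← sq_abs]
        gcongr
      rw [mul_pow] at this
      simp only [C₁, mul_assoc]
      gcongr
    have hid : h z = z := hδh z (hz.trans_le ((min_le_left _ _).trans (min_le_left _ _)))
    have hlow := hψneg (t := powerUtility p (1 + max (dotp y z) a) - dotp y (h z))
      (C := C₁ * ‖z‖ ^ 2) (by positivity) (by rw [hid]; linarith)
    rw [← Icut_eq ha hψa z] at hlow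
    have : 0 ≤ C₂ / r ^ 2 * ‖z‖ ^ 2 := by positivity
    rw [hφ]
    linarith
  · have hφ : r ^ 2 ≤ min (‖z‖ ^ 2) 1 :=
      le_min (by gcongr) (by nlinarith)
    have hmono : powerUtility p (1 + a) ≤ powerUtility p (1 + max (dotp y z) a) := by
      refine monotoneOn_powerUtility p ?_ ?_ (by gcongr; exact le_max_right _ _)
      · rw [mem_Ioi]; linarith
      · rw [mem_Ioi]; linarith [le_max_right (dotp y z) a]
    have hyh : dotp y (h z) ≤ ‖y‖ * M :=
      (le_abs_self _).trans ((abs_dotp_le y (h z)).trans (by gcongr; exact hM z))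
    have hlow := hψneg (t := powerUtility p (1 + max (dotp y z) a) - dotp y (h z))
      (C := C₂) hC₂ (by
        simp only [C₂]
        linarith [neg_abs_le (powerUtility p (1 + a))])
    rw [← Icut_eq ha hψa z] at hlow
    have h1 : C₂ ≤ C₂ / r ^ 2 * min (‖z‖ ^ 2) 1 := by
      calc C₂ = C₂ / r ^ 2 * r ^ 2 := by field_simp
        _ ≤ _ := by gcongr
    have h2 : 0 ≤ C₁ * min (‖z‖ ^ 2) 1 := by positivity
    linarith

end CutOff

/-- Let `ψ : ℝ → [0,1]` be continuous with `ψ(u) = 1` for `u ≥ -1 + 1/n`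
and `ψ(u) = 0` for `u < -1 + 1/(2n)`, and set `I_{y,n}(z) = I_y(z)·ψ(y^⊤z)`. Then
(i) `z ↦ I_{y,n}(z)/(|z|²∧1)` is continuous on `ℝ^d ∖ {0}` and bounded below there by a
constant `K`; and (ii) `F ↦ ∫ I_{y,n}(z) F(dz)` is sequentially lower semicontinuous on
Lévy measures with respect to weak convergence of the associated finite measures
`|z|²∧1·F`. -/
theorem stmt14 {d : ℕ} (hd : 1 ≤ d) (p : ℝ) (hp : p = 0 ∨ p < 0 ∨ (0 < p ∧ p < 1))
    (h : EuclideanSpace ℝ (Fin d) → EuclideanSpace ℝ (Fin d))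
    (hh : IsTruncation h) (hcont : Continuous h)
    (y : EuclideanSpace ℝ (Fin d)) (n : ℕ) (hn : 1 ≤ n)
    (ψ : ℝ → ℝ) (hψcont : Continuous ψ) (hψ01 : ∀ u, ψ u ∈ Set.Icc (0 : ℝ) 1)
    (hψone : ∀ u : ℝ, -1 + 1 / (n : ℝ) ≤ u → ψ u = 1)
    (hψzero : ∀ u : ℝ, u < -1 + 1 / (2 * (n : ℝ)) → ψ u = 0) :
    -- (i) continuity and a uniform lower bound off the origin
    (ContinuousOn (fun z => Icut p h ψ y z / min (‖z‖ ^ 2) 1)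
        {z : EuclideanSpace ℝ (Fin d) | z ≠ 0} ∧
      ∃ K : ℝ, ∀ z : EuclideanSpace ℝ (Fin d), z ≠ 0 →
        K ≤ Icut p h ψ y z / min (‖z‖ ^ 2) 1) ∧
    -- (ii) sequential lower semicontinuity of the integral functional
    (∀ (Fseq : ℕ → Measure (EuclideanSpace ℝ (Fin d)))
        (F : Measure (EuclideanSpace ℝ (Fin d))),
      (∀ k, IsLevyMeasure (Fseq k)) → IsLevyMeasure F →
      (∀ f : EuclideanSpace ℝ (Fin d) → ℝ, Continuous f → (∃ M : ℝ, ∀ x, |f x| ≤ M) →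
        Tendsto (fun k => ∫ z, f z ∂(sq1Measure (Fseq k))) atTop
          (nhds (∫ z, f z ∂(sq1Measure F)))) →
      eIntegral F (fun z => ((Icut p h ψ y z : ℝ) : EReal)) ≤
        Filter.liminf
          (fun k => eIntegral (Fseq k) (fun z => ((Icut p h ψ y z : ℝ) : EReal)))
          atTop) := by
  have ha : (-1 : ℝ) < -1 + 1 / (2 * (n : ℝ)) := by
    have : (0 : ℝ) < n := by exact_mod_cast hn
    linarith [show (0 : ℝ) < 1 / (2 * (n : ℝ)) by positivity]
  have hI : Continuous (Icut p h ψ y) := continuous_Icut ha hψzero hψcont hcont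
  obtain ⟨c, hc, hIc⟩ := exists_Icut_add_nonneg (p := p) (y := y) ha hψzero hψ01 hh
  refine ⟨⟨hI.continuousOn.div (by fun_prop) fun z hz => ?_, -c, fun z hz => ?_⟩,
    fun Fseq F hFseq hF hlim => eIntegral_le_liminf hFseq hF hlim hI hc hIc⟩
  · have : z ≠ 0 := hz
    positivity
  · rw [le_div_iff₀ (by positivity)]
    linarith [hIc z]
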